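/- Let N ≥ 2 and m ≥ 1 be integers and let k > 0. There exists a constant c = c_{N,m,k} > 0 such that for all distinct x, y in the open unit ball B = {x ∈ ℝ^N : |x| < 1} the Boggio kernel satisfies 0 < G₁(x,y) ≤ c |x−y|^{1−N}. -/

import Mathlib

/-- `ψ(x,y) = (1-|x|²)(1-|y|²)/|x-y|²`. -/
noncomputable def psiB {N : ℕ} (x y : EuclideanSpace ℝ (Fin N)) : ℝ :=
  (1 - ‖x‖ ^ 2) * (1 - ‖y‖ ^ 2) / ‖x - y‖ ^ 2

/-- Boggio's kernel on the unit ball with constant `k`. -/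
noncomputable def G1 (N m : ℕ) (k : ℝ) (x y : EuclideanSpace ℝ (Fin N)) : ℝ :=
  k / 2 * ‖x - y‖ ^ (2 * (m : ℝ) - N) *
    ∫ z in (0 : ℝ)..(psiB x y), z ^ (m - 1) * (z + 1) ^ (-(N : ℝ) / 2)

theorem continuousOn_boggio_integrand (n : ℕ) (s : ℝ) {T : ℝ} (hT : 0 ≤ T) :
    ContinuousOn (fun z : ℝ => z ^ n * (z + 1) ^ s) (Set.uIcc 0 T) := by
  refine (continuousOn_pow n).mul (ContinuousOn.rpow_const (by fun_prop) fun z hz => ?_)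
  rw [Set.uIcc_of_le hT] at hz
  left
  linarith [hz.1]

theorem boggio_integral_pos (n : ℕ) (s : ℝ) {T : ℝ} (hT : 0 < T) :
    0 < ∫ z in (0 : ℝ)..T, z ^ n * (z + 1) ^ s := by
  refine intervalIntegral.intervalIntegral_pos_of_pos_on
    (continuousOn_boggio_integrand n s hT.le).intervalIntegrable (fun z hz => ?_) hT
  have h0 : 0 < z := hz.1
  positivity

theorem boggio_integrand_le (n : ℕ) {s z : ℝ} (hs : s ≤ -1 / 2) (hz : 0 < z) :
    z ^ n * (z + 1) ^ s ≤ z ^ ((n : ℝ) - 1 / 2) := by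
  have h1 : (z + 1) ^ s ≤ (z + 1) ^ (-1 / 2 : ℝ) :=
    Real.rpow_le_rpow_of_exponent_le (by linarith) hs
  have h2 : (z + 1) ^ (-1 / 2 : ℝ) ≤ z ^ (-1 / 2 : ℝ) :=
    Real.rpow_le_rpow_of_nonpos hz (by linarith) (by norm_num)
  calc z ^ n * (z + 1) ^ s ≤ z ^ n * z ^ (-1 / 2 : ℝ) := by
        gcongr
        exact h1.trans h2
    _ = z ^ ((n : ℝ) - 1 / 2) := by
        rw [← Real.rpow_natCast, ← Real.rpow_add hz]
        ring_nf

theorem boggio_integral_le (n : ℕ) {s T : ℝ} (hs : s ≤ -1 / 2) (hT : 0 < T) :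
    ∫ z in (0 : ℝ)..T, z ^ n * (z + 1) ^ s ≤ 2 * T ^ ((n : ℝ) + 1 / 2) := by
  have hn : (0 : ℝ) ≤ n := n.cast_nonneg
  calc ∫ z in (0 : ℝ)..T, z ^ n * (z + 1) ^ s
      ≤ ∫ z in (0 : ℝ)..T, z ^ ((n : ℝ) - 1 / 2) :=
        intervalIntegral.integral_mono_on_of_le_Ioo hT.le
          (continuousOn_boggio_integrand n s hT.le).intervalIntegrable
          (intervalIntegral.intervalIntegrable_rpow' (by linarith))
          fun z hz => boggio_integrand_le n hs hz.1
    _ = T ^ ((n : ℝ) + 1 / 2) / ((n : ℝ) + 1 / 2) := by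
        have he : (n : ℝ) - 1 / 2 + 1 = n + 1 / 2 := by ring
        rw [integral_rpow (Or.inl (by linarith)), he, Real.zero_rpow (by linarith), sub_zero]
    _ ≤ 2 * T ^ ((n : ℝ) + 1 / 2) := by
        rw [div_le_iff₀ (by linarith)]
        nlinarith [mul_nonneg hn (Real.rpow_nonneg hT.le ((n : ℝ) + 1 / 2))]

theorem psiB_pos {N : ℕ} {x y : EuclideanSpace ℝ (Fin N)} (hx : ‖x‖ < 1) (hy : ‖y‖ < 1)
    (hxy : x ≠ y) : 0 < psiB x y := by
  have hr : 0 < ‖x - y‖ := norm_pos_iff.2 (sub_ne_zero.2 hxy)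
  have h1 : 0 < 1 - ‖x‖ ^ 2 := by nlinarith [norm_nonneg x]
  have h2 : 0 < 1 - ‖y‖ ^ 2 := by nlinarith [norm_nonneg y]
  unfold psiB
  positivity

theorem psiB_le {N : ℕ} {x y : EuclideanSpace ℝ (Fin N)} (hy : ‖y‖ < 1) :
    psiB x y ≤ ‖x - y‖ ^ (-2 : ℝ) := by
  have h2 : 0 ≤ 1 - ‖y‖ ^ 2 := by nlinarith [norm_nonneg y]
  rw [Real.rpow_neg (norm_nonneg _), Real.rpow_two, ← one_div]
  unfold psiB
  gcongr
  nlinarith [mul_nonneg (sq_nonneg ‖x‖) h2, sq_nonneg ‖y‖]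

/-- Pointwise bound for Boggio's kernel: there is `c = c_{N,m,k} > 0` with
`0 < G₁(x,y) ≤ c |x-y|^{1-N}` for all distinct `x, y` in the open unit ball. -/
theorem stmt_17 {N m : ℕ} (hN : 2 ≤ N) (hm : 0 < m) (k : ℝ) (hk : 0 < k) :
    ∃ c : ℝ, 0 < c ∧ ∀ x y : EuclideanSpace ℝ (Fin N),
      ‖x‖ < 1 → ‖y‖ < 1 → x ≠ y →
        0 < G1 N m k x y ∧ G1 N m k x y ≤ c * ‖x - y‖ ^ (1 - (N : ℝ)) := by
  refine ⟨k, hk, fun x y hx hy hxy => ?_⟩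
  have hr : 0 < ‖x - y‖ := norm_pos_iff.2 (sub_ne_zero.2 hxy)
  have hψ := psiB_pos hx hy hxy
  have hN' : (2 : ℝ) ≤ N := by exact_mod_cast hN
  obtain ⟨n, rfl⟩ : ∃ n, m = n + 1 := ⟨m - 1, by omega⟩
  unfold G1
  rw [Nat.add_sub_cancel]
  constructor
  · have := boggio_integral_pos n (-(N : ℝ) / 2) hψ
    positivity
  · have hI : ∫ z in (0 : ℝ)..(psiB x y), z ^ n * (z + 1) ^ (-(N : ℝ) / 2) ≤
        2 * ‖x - y‖ ^ (-2 * ((n : ℝ) + 1 / 2)) := by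
      refine (boggio_integral_le n (by linarith) hψ).trans ?_
      rw [Real.rpow_mul hr.le]
      gcongr
      exact psiB_le hy
    refine (mul_le_mul_of_nonneg_left hI (by positivity)).trans (le_of_eq ?_)
    have he : 1 - (N : ℝ) =
        (2 * ((n + 1 : ℕ) : ℝ) - N) + -2 * ((n : ℝ) + 1 / 2) := by
      push_cast
      ring
    rw [he, Real.rpow_add hr]
    ring
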